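/- arXiv:1801.04611 — 7 statements merged into one kernel-verified Lean document; each statement's English description precedes it below -/
import Mathlib

section
/- Let Γ be an additive subsemigroup of ℕ^d × ℕ and let P and Q be valuative points of Γ. Then every point of the closed segment [P, Q] all of whose coordinates are rational is again a valuative point of Γ. -/
/-- The set of valuative points of an additive subsemigroup `Γ ⊆ ℕ^d × ℕ`:
points `x ∈ ℝ^d` of the form `σ / k` for some `(σ, k) ∈ Γ` with `k > 0`. -/
def valPoints {d : ℕ} (Γ : AddSubsemigroup ((Fin d → ℕ) × ℕ)) : Set (Fin d → ℝ) :=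
  {x | ∃ p ∈ Γ, 0 < p.2 ∧ x = fun i => (p.1 i : ℝ) / (p.2 : ℝ)}

theorem AddSubsemigroup.nsmul_mem_of_pos {M : Type*} [AddMonoid M] (Γ : AddSubsemigroup M)
    {p : M} (hp : p ∈ Γ) {n : ℕ} (hn : 0 < n) : n • p ∈ Γ := by
  induction n, hn using Nat.le_induction with
  | base => simpa using hp
  | succ n _ ih => simpa only [succ_nsmul] using Γ.add_mem ih hp

/-- Convex combinations with positive rational weights `m / (m + n)` and `n / (m + n)` preserve
valuative points. -/
theorem weighted_mem_valPoints {d : ℕ} (Γ : AddSubsemigroup ((Fin d → ℕ) × ℕ))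
    {P Q : Fin d → ℝ} (hP : P ∈ valPoints Γ) (hQ : Q ∈ valPoints Γ) {m n : ℕ}
    (hm : 0 < m) (hn : 0 < n) :
    (fun i => (m * P i + n * Q i) / ((m : ℝ) + n)) ∈ valPoints Γ := by
  obtain ⟨p, hp, hp0, rfl⟩ := hP
  obtain ⟨q, hq, hq0, rfl⟩ := hQ
  refine ⟨(m * q.2) • p + (n * p.2) • q,
    Γ.add_mem (Γ.nsmul_mem_of_pos hp (by positivity)) (Γ.nsmul_mem_of_pos hq (by positivity)),
    ?_, ?_⟩
  · simp only [Prod.snd_add, Prod.smul_snd, smul_eq_mul]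
    positivity
  · funext i
    simp only [Prod.snd_add, Prod.smul_snd, Prod.fst_add, Prod.smul_fst, Pi.add_apply,
      Pi.smul_apply, smul_eq_mul]
    push_cast
    have h1 : (0 : ℝ) < p.2 := by exact_mod_cast hp0
    have h2 : (0 : ℝ) < q.2 := by exact_mod_cast hq0
    have h3 : (0 : ℝ) < m := by exact_mod_cast hm
    have h4 : (0 : ℝ) < n := by exact_mod_cast hn
    have h5 : (m * q.2 * p.2 + n * p.2 * q.2 : ℝ) = (m + n) * (p.2 * q.2) := by ring
    rw [h5]
    field_simp

theorem valPoints_coord_rational {d : ℕ} {Γ : AddSubsemigroup ((Fin d → ℕ) × ℕ)}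
    {P : Fin d → ℝ} (hP : P ∈ valPoints Γ) (i : Fin d) : ∃ q : ℚ, P i = (q : ℝ) := by
  obtain ⟨p, -, -, rfl⟩ := hP
  exact ⟨(p.1 i : ℚ) / p.2, by push_cast; rfl⟩

/-- if `P` and `Q` are valuative points of `Γ`, every point of the closed
segment `[P, Q]` with all coordinates rational is again a valuative point of `Γ`. -/
theorem rational_segment_points_valuative {d : ℕ} (hd : 1 ≤ d)
    (Γ : AddSubsemigroup ((Fin d → ℕ) × ℕ)) (P Q : Fin d → ℝ)
    (hP : P ∈ valPoints Γ) (hQ : Q ∈ valPoints Γ)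
    (x : Fin d → ℝ) (hx : x ∈ segment ℝ P Q) (hxrat : ∀ i, ∃ q : ℚ, x i = (q : ℝ)) :
    x ∈ valPoints Γ := by
  obtain ⟨a, b, ha, hb, hab, rfl⟩ := hx
  rcases eq_or_ne P Q with rfl | hne
  · rwa [← add_smul, hab, one_smul]
  rcases ha.eq_or_lt with rfl | ha
  · obtain rfl : b = 1 := by linarith
    simpa using hQ
  rcases hb.eq_or_lt with rfl | hb
  · obtain rfl : a = 1 := by linarith
    simpa using hP
  obtain ⟨i, hi⟩ := Function.ne_iff.mp hne
  obtain ⟨r, hr⟩ := hxrat i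
  obtain ⟨s, hs⟩ := valPoints_coord_rational hP i
  obtain ⟨t, ht⟩ := valPoints_coord_rational hQ i
  obtain ⟨c, rfl⟩ : ∃ c : ℚ, b = c := by
    refine ⟨(r - s) / (t - s), ?_⟩
    push_cast
    rw [← hr, ← hs, ← ht, eq_div_iff (sub_ne_zero.mpr hi.symm)]
    simp only [Pi.add_apply, Pi.smul_apply, smul_eq_mul]
    linear_combination (-P i) * hab
  have hc0 : 0 < c := by exact_mod_cast hb
  have hc1 : c < 1 := by
    have : (c : ℝ) < 1 := by linarith
    exact_mod_cast this
  obtain ⟨n, hn⟩ := Int.eq_ofNat_of_zero_le (Rat.num_pos.mpr hc0).le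
  have hn0 : 0 < n := by
    have := Rat.num_pos.mpr hc0
    omega
  have hlt : n < c.den := by
    have := Rat.num_lt_denom_iff.mpr hc1
    omega
  obtain ⟨m, hm⟩ := Nat.exists_eq_add_of_lt hlt
  have hden : (c.den : ℝ) = (m + 1 : ℕ) + n := by
    rw [hm]
    push_cast
    ring
  have hcn : (c : ℝ) = n / ((m + 1 : ℕ) + n) := by
    rw [← hden, Rat.cast_def, hn, Int.cast_natCast]
  convert weighted_mem_valPoints Γ hP hQ m.succ_pos hn0 using 1
  funext j
  obtain rfl : a = 1 - c := by linarith
  simp only [Pi.add_apply, Pi.smul_apply, smul_eq_mul, hcn]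
  have : ((m + 1 : ℕ) + n : ℝ) ≠ 0 := by positivity
  field_simp
  ring
end

section
/- Let Γ be an additive subsemigroup of ℕ^d × ℕ. Then every rational point in the relative interior of the Newton–Okounkov body Δ(Γ) is a valuative point of Γ. -/
/-- The Newton–Okounkov body of `Γ`: the closure of the convex hull of the set of
valuative points of `Γ`. -/
def NObody {d : ℕ} (Γ : AddSubsemigroup ((Fin d → ℕ) × ℕ)) : Set (Fin d → ℝ) :=
  closure (convexHull ℝ (valPoints Γ))

/-- In a finite-dimensional space, the intrinsic interior of the closure of a convex set
is contained in the set. -/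
theorem Convex.intrinsicInterior_closure_subset {E : Type*} [NormedAddCommGroup E]
    [NormedSpace ℝ E] [FiniteDimensional ℝ E] {C : Set E} (hC : Convex ℝ C) :
    intrinsicInterior ℝ (closure C) ⊆ C := by
  intro x hx
  obtain ⟨y, hy, rfl⟩ := mem_intrinsicInterior.1 hx
  let A := affineSpan ℝ (closure C)
  have : Nonempty A := ⟨y⟩
  let e : A.direction ≃ₜ A := (AffineIsometryEquiv.vaddConst ℝ y).toHomeomorph
  let f : A.direction → E := fun w => (w : E) + y
  have hf : ∀ w, ((e w : A) : E) = f w := fun w => rfl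
  have hsub : ∀ z ∈ closure C, ∃ w, f w = z := fun z hz =>
    ⟨e.symm ⟨z, subset_affineSpan ℝ _ hz⟩, by rw [← hf, Homeomorph.apply_symm_apply]⟩
  have hfe : Topology.IsInducing f := Topology.IsInducing.subtypeVal.comp e.isInducing
  have hconv : Convex ℝ (f ⁻¹' C) := by
    have := (hC.translate_preimage_left (y : E)).linear_preimage A.direction.subtype
    exact this
  have hcl : closure (f ⁻¹' C) = f ⁻¹' closure C := by
    rw [hfe.closure_eq_preimage_closure_image, Set.image_preimage_eq_of_subset]
    exact fun z hz => hsub z (subset_closure hz)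
  have hzero : (0 : A.direction) ∈ interior (closure (f ⁻¹' C)) := by
    have h0 : e 0 = y := by ext; simp [hf, f]
    have : f ⁻¹' closure C = e ⁻¹' (Subtype.val ⁻¹' closure C) := rfl
    rw [hcl, this, ← e.preimage_interior, Set.mem_preimage, h0]
    exact hy
  have hne : (interior (f ⁻¹' C)).Nonempty := by
    rw [hconv.interior_nonempty_iff_affineSpan_eq_top, ← top_le_iff,
      ← hconv.closure.interior_nonempty_iff_affineSpan_eq_top.1 ⟨0, hzero⟩, affineSpan_le]
    exact closure_minimal (subset_affineSpan ℝ _) (AffineSubspace.closed_of_finiteDimensional _)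
  rw [hconv.interior_closure_eq_interior_of_nonempty_interior hne] at hzero
  simpa [f] using interior_subset hzero

/-- The barycentric coordinates of a rational point with respect to affinely independent rational
points are rational. -/
theorem AffineIndependent.exists_rat_weights {ι κ : Type*} [Fintype ι] {z : ι → κ → ℝ}
    (hz : AffineIndependent ℝ z) (hzrat : ∀ i j, ∃ q : ℚ, z i j = q) {w : ι → ℝ}
    (hw : ∑ i, w i = 1) (hrat : ∀ j, ∃ q : ℚ, (∑ i, w i • z i) j = q) (i : ι) :
    ∃ q : ℚ, w i = q := by
  obtain ⟨π, hπ⟩ := (Algebra.linearMap ℚ ℝ).exists_leftInverse_of_injective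
    (LinearMap.ker_eq_bot.2 (algebraMap ℚ ℝ).injective)
  have hπq (q : ℚ) : π q = q := by simpa using LinearMap.congr_fun hπ q
  have hπmul (r : ℝ) (q : ℚ) : π (r * q) = π r * q := by
    rw [mul_comm, ← Rat.smul_def, map_smul, smul_eq_mul, mul_comm]
  refine ⟨π (w i), sub_eq_zero.1 ?_⟩
  refine affineIndependent_iff.1 hz Finset.univ (fun i => w i - π (w i)) ?_ ?_ i (Finset.mem_univ i)
  · have h : ∑ i, π (w i) = 1 := by
      rw [← map_sum, hw]; simpa using hπq 1
    rw [Finset.sum_sub_distrib, hw, sub_eq_zero]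
    exact_mod_cast h.symm
  · funext j
    obtain ⟨q, hq⟩ := hrat j
    choose a ha using fun i => hzrat i j
    simp only [Finset.sum_apply, Pi.smul_apply, smul_eq_mul, ha] at hq
    have h : ∑ i, π (w i) * a i = q := by
      simp only [← hπmul]
      rw [← map_sum, hq, hπq]
    simp only [Finset.sum_apply, Pi.smul_apply, smul_eq_mul, ha, sub_mul, Pi.zero_apply,
      Finset.sum_sub_distrib, hq, ← h]
    push_cast
    exact sub_self _

/-- Finitely many positive rationals have a common positive denominator. -/
theorem Rat.exists_nat_mul_eq_natCast {ι : Type*} [Fintype ι] (r : ι → ℚ) (hr : ∀ i, 0 < r i) :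
    ∃ N : ℕ, 0 < N ∧ ∃ n : ι → ℕ, ∀ i, 0 < n i ∧ (N : ℚ) * r i = n i := by
  have hN : 0 < ∏ i, (r i).den := Finset.prod_pos fun i _ => (r i).den_pos
  refine ⟨_, hN, ?_⟩
  have key (i : ι) : ∃ n : ℕ, 0 < n ∧ ((∏ i, (r i).den : ℕ) : ℚ) * r i = n := by
    obtain ⟨c, hc⟩ := Finset.dvd_prod_of_mem (fun i => (r i).den) (Finset.mem_univ i)
    obtain ⟨m, hm⟩ := Int.eq_ofNat_of_zero_le (Rat.num_pos.2 (hr i)).le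
    have h : ((∏ i, (r i).den : ℕ) : ℚ) * r i = (m * c : ℕ) := by
      have h₁ := Rat.den_mul_eq_num (r i)
      rw [hm] at h₁
      rw [hc]
      push_cast at h₁ ⊢
      rw [mul_right_comm, h₁]
    refine ⟨m * c, ?_, h⟩
    have := mul_pos (Nat.cast_pos (α := ℚ).2 hN) (hr i)
    rw [h] at this
    exact_mod_cast this
  choose n hn using key
  exact ⟨n, hn⟩

theorem AddSubsemigroup.sum_nsmul_mem {M ι : Type*} [AddCommMonoid M] (Γ : AddSubsemigroup M)
    {s : Finset ι} (hs : s.Nonempty) {n : ι → ℕ} {p : ι → M} (hn : ∀ i ∈ s, 0 < n i)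
    (hp : ∀ i ∈ s, p i ∈ Γ) : ∑ i ∈ s, n i • p i ∈ Γ := by
  refine Finset.sum_induction_nonempty _ (· ∈ Γ) (fun _ _ => Γ.add_mem) hs fun i hi => ?_
  rw [← Finset.card_range (n i), ← Finset.sum_const]
  exact Finset.sum_induction_nonempty _ (· ∈ Γ) (fun _ _ => Γ.add_mem)
    (Finset.nonempty_range_iff.2 (hn i hi).ne') fun _ _ => hp i hi

/-- Every rational point of the convex hull of the valuative points is valuative. -/
theorem mem_valPoints_of_mem_convexHull {d : ℕ} {Γ : AddSubsemigroup ((Fin d → ℕ) × ℕ)}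
    {x : Fin d → ℝ} (hx : x ∈ convexHull ℝ (valPoints Γ))
    (hxrat : ∀ i, ∃ q : ℚ, x i = (q : ℝ)) : x ∈ valPoints Γ := by
  obtain ⟨ι, _, z, w, hzV, hz, hw, hw1, rfl⟩ := eq_pos_convex_span_of_mem_convexHull hx
  choose p hpΓ hp0 hpz using fun i => hzV (Set.mem_range_self i)
  have hp0' (i : ι) : ((p i).2 : ℝ) ≠ 0 := by exact_mod_cast (hp0 i).ne'
  choose q hq using hz.exists_rat_weights
    (fun i j => ⟨(p i).1 j / (p i).2, by rw [hpz]; push_cast; rfl⟩) hw1 hxrat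
  have hq0 (i : ι) : 0 < q i := by
    have := hw i
    rw [hq] at this
    exact_mod_cast this
  obtain ⟨N, hN, n, hn⟩ := Rat.exists_nat_mul_eq_natCast (fun i => q i / (p i).2)
    fun i => div_pos (hq0 i) (Nat.cast_pos.2 (hp0 i))
  have hn' (i : ι) : (N : ℝ) * (w i / (p i).2) = n i := by
    rw [hq]
    exact_mod_cast congrArg (Rat.cast (K := ℝ)) (hn i).2
  have hne : (Finset.univ : Finset ι).Nonempty := by
    by_contra h
    simp [Finset.not_nonempty_iff_eq_empty.1 h] at hw1
  have hsnd : ((∑ i, n i • p i).2 : ℝ) = N := by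
    simp only [Prod.snd_sum, Prod.smul_snd, smul_eq_mul, Nat.cast_sum, Nat.cast_mul, ← hn']
    simp only [mul_assoc, div_mul_cancel₀ _ (hp0' _)]
    rw [← Finset.mul_sum, hw1, mul_one]
  refine ⟨∑ i, n i • p i, Γ.sum_nsmul_mem hne (fun i _ => (hn i).1) fun i _ => hpΓ i, ?_, ?_⟩
  · rw [Nat.cast_injective hsnd]
    exact hN
  · funext j
    have hN' : (N : ℝ) ≠ 0 := by exact_mod_cast hN.ne'
    rw [hsnd, eq_div_iff hN']
    simp only [Finset.sum_apply, Pi.smul_apply, smul_eq_mul, Prod.fst_sum, Prod.smul_fst,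
      Nat.cast_sum, Nat.cast_mul, ← hn', Finset.sum_mul]
    refine Finset.sum_congr rfl fun i _ => ?_
    rw [hpz]
    ring

/-- every rational point in the relative (intrinsic) interior of the
Newton–Okounkov body `Δ(Γ)` is a valuative point of `Γ`. -/
theorem rational_relint_NObody_valuative {d : ℕ} (hd : 1 ≤ d)
    (Γ : AddSubsemigroup ((Fin d → ℕ) × ℕ))
    (x : Fin d → ℝ) (hx : x ∈ intrinsicInterior ℝ (NObody Γ))
    (hxrat : ∀ i, ∃ q : ℚ, x i = (q : ℝ)) :
    x ∈ valPoints Γ :=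
  mem_valPoints_of_mem_convexHull
    ((convex_convexHull ℝ (valPoints Γ)).intrinsicInterior_closure_subset hx) hxrat
end

section
/- Let Γ be an additive subsemigroup of ℕ^d × ℕ that is generated (as an additive semigroup) by finitely many elements (σ₁, k₁), …, (σ_N, k_N) with every kᵢ > 0. Then the Newton–Okounkov body Δ(Γ) equals the convex hull of the finite set {σ₁/k₁, …, σ_N/k_N}; in particular Δ(Γ) is a compact polytope with rational vertices and no closure operation is needed. -/
/-- The slope `σ / k` of a sum of two elements of positive degree is a convex combination of their
slopes, so a convex set containing the slopes of a generating set contains all slopes. -/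
theorem slope_mem_of_mem_closure {d : ℕ} {s : Set ((Fin d → ℕ) × ℕ)} (hs : ∀ p ∈ s, 0 < p.2)
    {C : Set (Fin d → ℝ)} (hC : Convex ℝ C)
    (hsC : ∀ p ∈ s, (fun j => (p.1 j : ℝ) / (p.2 : ℝ)) ∈ C)
    {p : (Fin d → ℕ) × ℕ} (hp : p ∈ AddSubsemigroup.closure s) :
    0 < p.2 ∧ (fun j => (p.1 j : ℝ) / (p.2 : ℝ)) ∈ C := by
  induction hp using AddSubsemigroup.closure_induction with
  | mem p hp => exact ⟨hs p hp, hsC p hp⟩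
  | add p q _ _ ihp ihq =>
    obtain ⟨hp, hpC⟩ := ihp
    obtain ⟨hq, hqC⟩ := ihq
    refine ⟨Nat.add_pos_left hp _, ?_⟩
    have hp' : (0 : ℝ) < p.2 := Nat.cast_pos.2 hp
    have hq' : (0 : ℝ) < q.2 := Nat.cast_pos.2 hq
    convert convex_iff_div.1 hC hpC hqC hp'.le hq'.le (add_pos hp' hq') using 1
    ext j
    simp only [Prod.fst_add, Prod.snd_add, Pi.add_apply, Pi.smul_apply, smul_eq_mul, Nat.cast_add]
    field_simp

/-- The valuative points of a semigroup generated in positive degrees have the same convex hull as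
the slopes of the generators. -/
theorem convexHull_valPoints_closure_range {d : ℕ} {ι : Type*} (g : ι → (Fin d → ℕ) × ℕ)
    (hg : ∀ i, 0 < (g i).2) :
    convexHull ℝ (valPoints (AddSubsemigroup.closure (Set.range g))) =
      convexHull ℝ (Set.range fun i => fun j => ((g i).1 j : ℝ) / ((g i).2 : ℝ)) := by
  apply Set.Subset.antisymm
  · refine convexHull_min ?_ (convex_convexHull ℝ _)
    rintro _ ⟨p, hp, -, rfl⟩
    exact (slope_mem_of_mem_closure (Set.forall_mem_range.2 hg) (convex_convexHull ℝ _)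
      (Set.forall_mem_range.2 fun i => subset_convexHull ℝ _ (Set.mem_range_self i)) hp).2
  · apply convexHull_mono
    rintro _ ⟨i, rfl⟩
    exact ⟨g i, AddSubsemigroup.subset_closure ⟨i, rfl⟩, hg i, rfl⟩

/-- if `Γ` is generated as an additive semigroup by finitely many
elements `(σ₁, k₁), …, (σ_N, k_N)` with all `kᵢ > 0`, then `Δ(Γ)` equals the convex
hull of the finite set `{σ₁/k₁, …, σ_N/k_N}`; in particular it is a compact polytope
with rational vertices and no closure operation is needed. -/
theorem NObody_eq_convexHull_of_fg {d N : ℕ} (hd : 1 ≤ d)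
    (g : Fin N → (Fin d → ℕ) × ℕ) (hg : ∀ i, 0 < (g i).2)
    (Γ : AddSubsemigroup ((Fin d → ℕ) × ℕ))
    (hΓ : Γ = AddSubsemigroup.closure (Set.range g)) :
    NObody Γ = convexHull ℝ (Set.range fun i => fun j => ((g i).1 j : ℝ) / ((g i).2 : ℝ))
      ∧ IsCompact (NObody Γ)
      ∧ convexHull ℝ (valPoints Γ) = NObody Γ := by
  subst hΓ
  have hfin := Set.finite_range fun i => fun j => ((g i).1 j : ℝ) / ((g i).2 : ℝ)
  have hbody : NObody (AddSubsemigroup.closure (Set.range g)) =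
      convexHull ℝ (Set.range fun i => fun j => ((g i).1 j : ℝ) / ((g i).2 : ℝ)) := by
    rw [NObody, convexHull_valPoints_closure_range g hg, (hfin.isClosed_convexHull ℝ).closure_eq]
  refine ⟨hbody, ?_, ?_⟩
  · rw [hbody]
    exact hfin.isCompact_convexHull ℝ
  · rw [hbody, convexHull_valPoints_closure_range g hg]
end

section
/- Let Γ be an additive subsemigroup of ℕ^d × ℕ such that every nonzero element of Γ has positive last coordinate. If Γ is finitely generated as an additive semigroup, then every rational point of the Newton–Okounkov body Δ(Γ) is a valuative point of Γ. -/
/-- A convex combination of rational points which is itself rational can be written with rational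
weights. -/
theorem mem_of_mem_convexHull_of_rational {d : ℕ} {T s : Set (Fin d → ℝ)} (hTs : T ⊆ s)
    (hs : Convex ℚ s) (hT : ∀ t ∈ T, ∀ i, ∃ q : ℚ, t i = (q : ℝ)) {x : Fin d → ℝ}
    (hx : x ∈ convexHull ℝ T) (hxrat : ∀ i, ∃ q : ℚ, x i = (q : ℝ)) : x ∈ s := by
  obtain ⟨ι, _, z, w, hz, hind, hw, hw1, rfl⟩ := eq_pos_convex_span_of_mem_convexHull hx
  obtain ⟨φ, hφ⟩ := (Algebra.linearMap ℚ ℝ).exists_leftInverse_of_injective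
    (LinearMap.ker_eq_bot.2 (algebraMap ℚ ℝ).injective)
  have hφq (q : ℚ) : φ (q : ℝ) = q := by simpa using LinearMap.congr_fun hφ q
  have hφmul (a : ℝ) (q : ℚ) : φ (a * q) = φ a * q := by
    rw [mul_comm, ← Rat.smul_def, map_smul, smul_eq_mul, mul_comm]
  have hφw1 : ∑ i, φ (w i) = 1 := by
    rw [← map_sum, hw1]
    simpa using hφq 1
  have hwφ : ∀ i, w i = (φ (w i) : ℝ) := by
    intro i
    refine sub_eq_zero.1 (affineIndependent_iff.1 hind Finset.univ
      (fun i => w i - (φ (w i) : ℝ)) ?_ ?_ i (Finset.mem_univ i))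
    · rw [Finset.sum_sub_distrib, hw1, ← Rat.cast_sum, hφw1]
      simp
    · funext j
      choose q hq using fun i => hT (z i) (hz ⟨i, rfl⟩) j
      obtain ⟨r, hr⟩ := hxrat j
      simp only [Finset.sum_apply, Pi.smul_apply, smul_eq_mul, hq] at hr
      have hφr : ∑ i, φ (w i) * q i = r := by
        rw [← hφq r, ← hr, map_sum]
        exact Finset.sum_congr rfl fun i _ => (hφmul _ _).symm
      simp only [Finset.sum_apply, Pi.smul_apply, smul_eq_mul, hq, sub_mul,
        Finset.sum_sub_distrib, hr, Pi.zero_apply]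
      rw [← hφr]
      push_cast
      ring
  have hsum : ∑ i, w i • z i = ∑ i, φ (w i) • z i :=
    Finset.sum_congr rfl fun i _ => by rw [← Rat.cast_smul_eq_qsmul ℝ, ← hwφ i]
  rw [hsum]
  refine hs.sum_mem (fun i _ => ?_) hφw1 fun i _ => hTs (hz ⟨i, rfl⟩)
  have := (hw i).le
  rw [hwφ i] at this
  exact_mod_cast this

/-- The valuative points are closed under convex combinations with rational weights. -/
theorem convex_rat_valPoints {d : ℕ} (Γ : AddSubsemigroup ((Fin d → ℕ) × ℕ)) :
    Convex ℚ (valPoints Γ) := by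
  rw [convex_iff_forall_pos]
  rintro _ ⟨p, hp, hp0, rfl⟩ _ ⟨q, hq, hq0, rfl⟩ a b ha hb hab
  obtain ⟨m, M, hm, hM, rfl⟩ : ∃ m M : ℕ, 0 < m ∧ 0 < M ∧ a = m / M :=
    ⟨a.num.toNat, a.den, by have := Rat.num_pos.2 ha; omega, a.den_pos, by
      have h : ((a.num.toNat : ℤ) : ℚ) = a.num := by
        rw [Int.toNat_of_nonneg (Rat.num_pos.2 ha).le]
      rw [← Int.cast_natCast a.num.toNat, h, Rat.num_div_den]⟩
  obtain rfl : b = 1 - m / M := by linarith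
  have hmM : m < M := by
    rw [sub_pos, div_lt_one (by positivity)] at hb
    exact_mod_cast hb
  obtain ⟨n, rfl⟩ := Nat.exists_eq_add_of_lt hmM
  refine ⟨(m * q.2) • p + ((n + 1) * p.2) • q,
    Γ.add_mem (Γ.nsmul_mem_of_pos hp (by positivity)) (Γ.nsmul_mem_of_pos hq (by positivity)),
    ?_, ?_⟩
  · simp only [Prod.snd_add, Prod.smul_snd, smul_eq_mul]
    positivity
  · funext i
    simp only [Pi.add_apply, Pi.smul_apply, Rat.smul_def, Prod.fst_add, Prod.snd_add,
      Prod.smul_fst, Prod.smul_snd, smul_eq_mul]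
    push_cast
    have : (p.2 : ℝ) ≠ 0 := by positivity
    have : (q.2 : ℝ) ≠ 0 := by positivity
    have : (m + n + 1 : ℝ) ≠ 0 := by positivity
    have : (m * q.2 * p.2 + (n + 1) * p.2 * q.2 : ℝ) ≠ 0 := by positivity
    field_simp
    ring

/-- The valuative points of the semigroup generated by `S` are convex combinations of those given
by elements of `S`. -/
theorem valPoints_closure_subset {d : ℕ} {S : Set ((Fin d → ℕ) × ℕ)}
    (hpos : ∀ p ∈ AddSubsemigroup.closure S, p ≠ 0 → 0 < p.2) :
    valPoints (AddSubsemigroup.closure S) ⊆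
      convexHull ℝ ((fun p i => (p.1 i : ℝ) / (p.2 : ℝ)) '' {p ∈ S | 0 < p.2}) := by
  rintro _ ⟨p, hp, hp0, rfl⟩
  induction hp using AddSubsemigroup.closure_induction with
  | mem p hp => exact subset_convexHull _ _ ⟨p, ⟨hp, hp0⟩, rfl⟩
  | add p q hp hq ihp ihq =>
    by_cases hpz : p = 0
    · subst hpz
      simp only [zero_add] at hp0 ⊢
      exact ihq hp0
    by_cases hqz : q = 0
    · subst hqz
      simp only [add_zero] at hp0 ⊢
      exact ihp hp0
    have hp2 := hpos p hp hpz
    have hq2 := hpos q hq hqz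
    have hp' : (0 : ℝ) < p.2 := by exact_mod_cast hp2
    have hq' : (0 : ℝ) < q.2 := by exact_mod_cast hq2
    convert convex_iff_div.1 (convex_convexHull ℝ _) (ihp hp2) (ihq hq2) hp'.le hq'.le
      (add_pos hp' hq') using 1
    funext i
    simp only [Pi.add_apply, Pi.smul_apply, Prod.fst_add, Prod.snd_add, smul_eq_mul]
    push_cast
    field_simp

/-- if every nonzero element of `Γ` has positive last coordinate and `Γ`
is finitely generated as an additive semigroup, then every rational point of `Δ(Γ)` is
a valuative point of `Γ`. -/
theorem rational_points_NObody_valuative_of_fg {d : ℕ} (hd : 1 ≤ d)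
    (Γ : AddSubsemigroup ((Fin d → ℕ) × ℕ))
    (hpos : ∀ p ∈ Γ, p ≠ 0 → 0 < p.2)
    (hfg : ∃ S : Finset ((Fin d → ℕ) × ℕ), Γ = AddSubsemigroup.closure (S : Set ((Fin d → ℕ) × ℕ)))
    (x : Fin d → ℝ) (hx : x ∈ NObody Γ) (hxrat : ∀ i, ∃ q : ℚ, x i = (q : ℝ)) :
    x ∈ valPoints Γ := by
  obtain ⟨S, rfl⟩ := hfg
  set T : Set (Fin d → ℝ) :=
    (fun p i => (p.1 i : ℝ) / (p.2 : ℝ)) '' {p ∈ (S : Set ((Fin d → ℕ) × ℕ)) | 0 < p.2}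
  have hfin : T.Finite := (S.finite_toSet.subset (Set.sep_subset _ _)).image _
  have hxT : x ∈ convexHull ℝ T :=
    closure_minimal (convexHull_min (valPoints_closure_subset hpos) (convex_convexHull ℝ T))
      (hfin.isClosed_convexHull ℝ) hx
  refine mem_of_mem_convexHull_of_rational ?_ (convex_rat_valPoints _) ?_ hxT hxrat
  · rintro _ ⟨p, ⟨hp, hp0⟩, rfl⟩
    exact ⟨p, AddSubsemigroup.subset_closure hp, hp0, rfl⟩
  · rintro _ ⟨p, -, rfl⟩ i
    exact ⟨p.1 i / p.2, by push_cast; rfl⟩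
end

section
/- Let A and B be commutative integral domains and let φ : A → B be an injective ring homomorphism making B a finitely generated A-module. If the induced homomorphism of fraction fields Frac(A) → Frac(B) is surjective (equivalently, an isomorphism), then there exists a nonzero element a ∈ A such that the induced ring homomorphism between the localizations A[1/a] → B[1/φ(a)] is bijective. -/
/-- A finitely generated module over a domain all of whose elements have a nonzero multiple in a
submodule `N` has a single nonzero scalar multiplying it into `N`. -/
theorem Module.Finite.exists_ne_zero_forall_smul_mem {R M : Type*} [CommRing R] [IsDomain R]
    [AddCommGroup M] [Module R M] [Module.Finite R M] (N : Submodule R M)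
    (h : ∀ m : M, ∃ r : R, r ≠ 0 ∧ r • m ∈ N) :
    ∃ r : R, r ≠ 0 ∧ ∀ m : M, r • m ∈ N := by
  obtain ⟨S, hS⟩ := (Module.Finite.fg_top : (⊤ : Submodule R M).FG)
  choose s hs hsN using h
  refine ⟨∏ m ∈ S, s m, Finset.prod_ne_zero_iff.mpr fun m _ => hs m, fun m => ?_⟩
  have hle : Submodule.span R (S : Set M) ≤
      N.comap (LinearMap.lsmul R M (∏ m ∈ S, s m)) := by
    rw [Submodule.span_le]
    intro x hx
    obtain ⟨c, hc⟩ := Finset.dvd_prod_of_mem s (Finset.mem_coe.mp hx)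
    change (∏ m ∈ S, s m) • x ∈ N
    rw [hc, mul_comm, mul_smul]
    exact N.smul_mem c (hsN x)
  exact hle (hS ▸ Submodule.mem_top)

/-- let `A ⊆ B` be an inclusion (an injective ring homomorphism,
here realized by an algebra structure with injective structure map) of integral
domains making `B` a finitely generated `A`-module.  If the induced homomorphism of
fraction fields `Frac(A) → Frac(B)` is surjective (i.e. every fraction `y/t` of `B`
can be written as a fraction of elements coming from `A`), then there is a nonzero
`a ∈ A` such that the induced ring homomorphism of localizations
`A[1/a] → B[1/φ(a)]` is bijective. -/
theorem exists_nonzero_localization_bijective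
    {A B : Type*} [CommRing A] [IsDomain A] [CommRing B] [IsDomain B]
    [Algebra A B] (hinj : Function.Injective (algebraMap A B))
    [Module.Finite A B]
    (hsurj : ∀ y t : B, t ≠ 0 →
      ∃ x s : A, s ≠ 0 ∧ y * algebraMap A B s = algebraMap A B x * t) :
    ∃ a : A, a ≠ 0 ∧
      Function.Bijective
        (IsLocalization.Away.map (Localization.Away a)
          (Localization.Away (algebraMap A B a)) (algebraMap A B) a) := by
  obtain ⟨a, ha, hmem⟩ := Module.Finite.exists_ne_zero_forall_smul_mem
    (LinearMap.range (Algebra.linearMap A B)) fun b => by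
      obtain ⟨x, s, hs, h⟩ := hsurj b 1 one_ne_zero
      exact ⟨s, hs, x, by rw [Algebra.smul_def, mul_comm, h, mul_one, Algebra.linearMap_apply]⟩
  refine ⟨a, ha, ?_, ?_⟩
  · rw [IsLocalization.Away.map_injective_iff]
    intro x hx
    exact ⟨0, by simp [(injective_iff_map_eq_zero _).mp hinj x hx]⟩
  · rw [IsLocalization.Away.map_surjective_iff]
    intro b
    obtain ⟨x, hx⟩ := hmem b
    exact ⟨x, 1, by rw [pow_one, ← Algebra.smul_def, ← hx, Algebra.linearMap_apply]⟩
end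

section
/- Let A, B, A′, B′ be commutative ℕ-graded rings, with gradings A = ⊕ᵢ Aᵢ etc., and for a graded ring R write R⁺ for its irrelevant ideal ⊕_{i>0} Rᵢ. Let ι : A → B and ι′ : A′ → B′ be ring homomorphisms mapping each graded piece into the graded piece of the same degree, and let r_A : A → A′ and r_B : B → B′ be ring homomorphisms that map each graded piece of degree i surjectively onto the graded piece of degree i and are injective on the degree-0 piece, such that ι′ ∘ r_A = r_B ∘ ι. Assume that for every homogeneous prime ideal 𝔭 of B with B⁺ ⊄ 𝔭, the preimage ι⁻¹(𝔭) satisfies A⁺ ⊄ ι⁻¹(𝔭). Then for every homogeneous prime ideal 𝔮 of B′ with B′⁺ ⊄ 𝔮, the preimage ι′⁻¹(𝔮) satisfies A′⁺ ⊄ ι′⁻¹(𝔮). -/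
/-- Let `A, B, A′, B′` be commutative ℕ-graded rings with gradings
`𝒜, ℬ, 𝒜′, ℬ′`; write `R⁺` for the irrelevant ideal of a graded ring `R`.  Let
`ι : A → B` and `ι′ : A′ → B′` be graded (degree-preserving) ring homomorphisms, and
`r_A : A → A′`, `r_B : B → B′` ring homomorphisms mapping each graded piece onto the
corresponding graded piece (degree-wise surjectively) and injectively in degree `0`,
with `ι′ ∘ r_A = r_B ∘ ι`.  If for every relevant homogeneous prime `𝔭` of `B` the
preimage `ι⁻¹(𝔭)` is relevant (does not contain `A⁺`), then for every relevant
homogeneous prime `𝔮` of `B′` the preimage `ι′⁻¹(𝔮)` is relevant (does not contain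
`A′⁺`). -/
theorem relevant_preimage_of_restriction
    {A B A' B' : Type*} [CommRing A] [CommRing B] [CommRing A'] [CommRing B']
    (𝒜 : ℕ → AddSubgroup A) (ℬ : ℕ → AddSubgroup B)
    (𝒜' : ℕ → AddSubgroup A') (ℬ' : ℕ → AddSubgroup B')
    [GradedRing 𝒜] [GradedRing ℬ] [GradedRing 𝒜'] [GradedRing ℬ']
    (ι : A →+* B) (ι' : A' →+* B') (rA : A →+* A') (rB : B →+* B')
    (hι : ∀ i : ℕ, ∀ a ∈ 𝒜 i, ι a ∈ ℬ i)
    (hι' : ∀ i : ℕ, ∀ a' ∈ 𝒜' i, ι' a' ∈ ℬ' i)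
    (hrA_maps : ∀ i : ℕ, ∀ a ∈ 𝒜 i, rA a ∈ 𝒜' i)
    (hrA_surj : ∀ i : ℕ, ∀ a' ∈ 𝒜' i, ∃ a ∈ 𝒜 i, rA a = a')
    (hrA_inj : ∀ a ∈ 𝒜 0, ∀ b ∈ 𝒜 0, rA a = rA b → a = b)
    (hrB_maps : ∀ i : ℕ, ∀ b ∈ ℬ i, rB b ∈ ℬ' i)
    (hrB_surj : ∀ i : ℕ, ∀ b' ∈ ℬ' i, ∃ b ∈ ℬ i, rB b = b')
    (hrB_inj : ∀ b ∈ ℬ 0, ∀ c ∈ ℬ 0, rB b = rB c → b = c)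
    (hcomm : ι'.comp rA = rB.comp ι)
    (hglobal : ∀ 𝔭 : Ideal B, 𝔭.IsPrime → Ideal.IsHomogeneous ℬ 𝔭 →
      ¬ (HomogeneousIdeal.irrelevant ℬ).toIdeal ≤ 𝔭 →
      ¬ (HomogeneousIdeal.irrelevant 𝒜).toIdeal ≤ Ideal.comap ι 𝔭) :
    ∀ 𝔮 : Ideal B', 𝔮.IsPrime → Ideal.IsHomogeneous ℬ' 𝔮 →
      ¬ (HomogeneousIdeal.irrelevant ℬ').toIdeal ≤ 𝔮 →
      ¬ (HomogeneousIdeal.irrelevant 𝒜').toIdeal ≤ Ideal.comap ι' 𝔮 := by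
  intro 𝔮 h𝔮 h𝔮_hom h𝔮_rel hle
  let gB : GradedRingHom ℬ ℬ' := ⟨rB, fun {i x} hx => hrB_maps i x hx⟩
  let 𝔮H : HomogeneousIdeal ℬ' := ⟨𝔮, h𝔮_hom⟩
  refine hglobal (𝔮.comap rB) inferInstance (𝔮H.comap gB).isHomogeneous ?_ ?_
  · refine fun h => h𝔮_rel ((HomogeneousIdeal.toIdeal_irrelevant_le ℬ').2 fun i hi b' hb' => ?_)
    obtain ⟨b, hb, rfl⟩ := hrB_surj i b' hb'
    exact h (HomogeneousIdeal.mem_irrelevant_of_mem ℬ hi hb)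
  · refine (HomogeneousIdeal.toIdeal_irrelevant_le 𝒜).2 fun i hi a ha => ?_
    have h : ι' (rA a) ∈ 𝔮 :=
      hle (HomogeneousIdeal.mem_irrelevant_of_mem 𝒜' hi (hrA_maps i a ha))
    rwa [← RingHom.comp_apply, hcomm] at h
end

section
/- Let Γ be an additive subsemigroup of ℕ^d × ℕ, let g = (τ, k₀) ∈ Γ with k₀ > 0, and let Γ′ be an additive subsemigroup of ℕ^d × ℕ with g + Γ ⊆ Γ′ ⊆ Γ. Then Δ(Γ′) = Δ(Γ), and the subgroups of ℤ^{d+1} generated by Γ′ and by Γ coincide. -/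
/-- The canonical embedding `ℕ^d × ℕ → ℤ^d × ℤ`. -/
def toIntLattice {d : ℕ} (p : (Fin d → ℕ) × ℕ) : (Fin d → ℤ) × ℤ :=
  (fun i => (p.1 i : ℤ), (p.2 : ℤ))

open Filter Topology

theorem AddSubsemigroup.succ_nsmul_mem {M : Type*} [AddMonoid M] (S : AddSubsemigroup M) {x : M}
    (hx : x ∈ S) (n : ℕ) : (n + 1) • x ∈ S := by
  induction n with
  | zero => simpa using hx
  | succ n ih => simpa [succ_nsmul x (n + 1)] using S.add_mem ih hx

theorem valPoints_mono {d : ℕ} {Γ Γ' : AddSubsemigroup ((Fin d → ℕ) × ℕ)}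
    (h : (Γ' : Set ((Fin d → ℕ) × ℕ)) ⊆ Γ) : valPoints Γ' ⊆ valPoints Γ := by
  rintro x ⟨p, hp, hpos, rfl⟩
  exact ⟨p, h hp, hpos, rfl⟩

theorem valPoints_subset_closure_valPoints {d : ℕ} {Γ Γ' : AddSubsemigroup ((Fin d → ℕ) × ℕ)}
    {g : (Fin d → ℕ) × ℕ} (h : ∀ x ∈ Γ, g + x ∈ Γ') :
    valPoints Γ ⊆ closure (valPoints Γ') := by
  rintro _ ⟨p, hp, hpos, rfl⟩
  let u : ℕ → Fin d → ℝ := fun n i => (g.1 i + p.1 i * n : ℝ) / (g.2 + p.2 * n)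
  have hu : Tendsto u atTop (𝓝 fun i => (p.1 i : ℝ) / p.2) :=
    tendsto_pi_nhds.2 fun i =>
      tendsto_add_mul_div_add_mul_atTop_nhds _ _ _ (Nat.cast_ne_zero.2 hpos.ne')
  refine mem_closure_of_tendsto ((tendsto_add_atTop_iff_nat 1).2 hu) (.of_forall fun n => ?_)
  refine ⟨g + (n + 1) • p, h _ (Γ.succ_nsmul_mem hp n), ?_, ?_⟩
  · simp only [Prod.snd_add, Prod.smul_snd, smul_eq_mul]
    positivity
  · ext i
    simp [u, mul_comm]

theorem NObody_eq_of_translate {d : ℕ} {Γ Γ' : AddSubsemigroup ((Fin d → ℕ) × ℕ)}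
    {g : (Fin d → ℕ) × ℕ} (h : ∀ x ∈ Γ, g + x ∈ Γ')
    (h' : (Γ' : Set ((Fin d → ℕ) × ℕ)) ⊆ Γ) : NObody Γ' = NObody Γ := by
  refine (closure_mono (convexHull_mono (valPoints_mono h'))).antisymm ?_
  refine closure_minimal (convexHull_min ?_ (convex_convexHull ℝ _).closure) isClosed_closure
  exact (valPoints_subset_closure_valPoints h).trans (closure_mono (subset_convexHull ℝ _))

theorem toIntLattice_add {d : ℕ} (p q : (Fin d → ℕ) × ℕ) :
    toIntLattice (p + q) = toIntLattice p + toIntLattice q := by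
  ext <;> simp [toIntLattice]

theorem closure_toIntLattice_eq_of_translate {d : ℕ}
    {Γ Γ' : AddSubsemigroup ((Fin d → ℕ) × ℕ)} {g : (Fin d → ℕ) × ℕ} (hg : g ∈ Γ)
    (h : ∀ x ∈ Γ, g + x ∈ Γ') (h' : (Γ' : Set ((Fin d → ℕ) × ℕ)) ⊆ Γ) :
    AddSubgroup.closure (toIntLattice '' (Γ' : Set ((Fin d → ℕ) × ℕ))) =
      AddSubgroup.closure (toIntLattice '' (Γ : Set ((Fin d → ℕ) × ℕ))) := by
  refine (AddSubgroup.closure_mono (Set.image_mono h')).antisymm ?_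
  rw [AddSubgroup.closure_le]
  set G := AddSubgroup.closure (toIntLattice '' (Γ' : Set ((Fin d → ℕ) × ℕ)))
  have mem (x) (hx : x ∈ Γ) : toIntLattice g + toIntLattice x ∈ G := by
    rw [← toIntLattice_add]
    exact AddSubgroup.subset_closure (Set.mem_image_of_mem _ (h x hx))
  have hgG : toIntLattice g ∈ G := by
    have h3 := mem _ (Γ.add_mem hg hg)
    rw [toIntLattice_add] at h3
    exact (G.add_mem_cancel_right (mem g hg)).1 h3
  rintro _ ⟨x, hx, rfl⟩
  exact (G.add_mem_cancel_left hgG).1 (mem x hx)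

/-- let `g = (τ, k₀) ∈ Γ` with `k₀ > 0` and let `Γ′` be an additive
subsemigroup with `g + Γ ⊆ Γ′ ⊆ Γ`.  Then `Δ(Γ′) = Δ(Γ)`, and the subgroups of
`ℤ^{d+1}` generated by `Γ′` and by `Γ` coincide. -/
theorem NObody_and_group_of_translate {d : ℕ} (hd : 1 ≤ d)
    (Γ Γ' : AddSubsemigroup ((Fin d → ℕ) × ℕ))
    (g : (Fin d → ℕ) × ℕ) (hgΓ : g ∈ Γ) (hg : 0 < g.2)
    (hsub1 : ∀ x ∈ Γ, g + x ∈ Γ') (hsub2 : (Γ' : Set ((Fin d → ℕ) × ℕ)) ⊆ Γ) :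
    NObody Γ' = NObody Γ ∧
      AddSubgroup.closure (toIntLattice '' (Γ' : Set ((Fin d → ℕ) × ℕ))) =
        AddSubgroup.closure (toIntLattice '' (Γ : Set ((Fin d → ℕ) × ℕ))) := by
  exact ⟨NObody_eq_of_translate hsub1 hsub2,
    closure_toIntLattice_eq_of_translate hgΓ hsub1 hsub2⟩
end
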